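/- arXiv:2504.14803 — 3 statements merged into one kernel-verified Lean document; each statement's English description precedes it below -/
import Mathlib

section
/- Let A be a nonempty finite index set, and for each i ∈ A let F_i be a nonempty finite family of nonempty closed bounded intervals of ℝ, and set S_i = ⋃_{I ∈ F_i} I. If there exists a point q ∈ ⋂_{i ∈ A} S_i, then there exist an index i ∈ A and an interval I ∈ F_i such that sup I ∈ ⋂_{j ∈ A} S_j. -/
/-- For each `i` in a nonempty finite index set `A`, let `F i` be a
nonempty finite family of nonempty closed bounded intervals of `ℝ` (encoded as pairs
`p` with `p.1 ≤ p.2`, representing `[p.1, p.2]`), and let `S i` be their union. If some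
point `q` lies in every `S i`, then there is an index `i` and an interval `p ∈ F i`
whose right endpoint `p.2` lies in every `S j`. -/
theorem endpoint_in_common_intersection {A : Type*} [Fintype A] [Nonempty A]
    (F : A → Finset (ℝ × ℝ)) (hFne : ∀ i, (F i).Nonempty)
    (hF : ∀ i, ∀ p ∈ F i, p.1 ≤ p.2)
    (S : A → Set ℝ) (hS : ∀ i, S i = ⋃ p ∈ F i, Set.Icc p.1 p.2)
    (q : ℝ) (hq : ∀ i, q ∈ S i) :
    ∃ i : A, ∃ p ∈ F i, ∀ j : A, p.2 ∈ S j := by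
  have h : ∀ i, ∃ p ∈ F i, p.1 ≤ q ∧ q ≤ p.2 := by
    intro i
    have := hq i
    rw [hS i] at this
    simp only [Set.mem_iUnion, Set.mem_Icc, exists_prop] at this
    exact this
  choose f hf h1 h2 using h
  obtain ⟨i, hi⟩ := Finite.exists_min (fun i => (f i).2)
  refine ⟨i, f i, hf i, fun j => ?_⟩
  rw [hS j]
  simp only [Set.mem_iUnion, Set.mem_Icc, exists_prop]
  exact ⟨f j, hf j, (h1 j).trans (h2 i), hi j⟩
end

section
/- Let A be a finite index set, let k ≥ 1, and for each i ∈ A let F_i be a nonempty finite family of nonempty closed bounded intervals of ℝ, and set S_i = ⋃_{I ∈ F_i} I. Suppose there exists a finite set Q ⊆ ℝ with |Q| ≤ k such that for every i ∈ A there is some q ∈ Q with q ∈ S_i. Then there exists a set Q′ with |Q′| ≤ k, all of whose elements are endpoints of intervals in ⋃_{i ∈ A} F_i (i.e., Q′ ⊆ { inf I, sup I : I ∈ F_i, i ∈ A }), such that for every i ∈ A there is some q ∈ Q′ with q ∈ S_i. -/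
/-- For each `i` in a finite index set `A`, let `F i` be a nonempty
finite family of nonempty closed bounded intervals of `ℝ` (pairs `p` with `p.1 ≤ p.2`,
representing `[p.1, p.2]`) and `S i` their union. If some set `Q` of at most `k` points
meets every `S i`, then there is a set `Q'` of at most `k` points, each an endpoint of
an interval in some `F i`, that also meets every `S i`. -/
theorem cover_by_interval_endpoints {A : Type*} [Fintype A] (k : ℕ) (hk : 1 ≤ k)
    (F : A → Finset (ℝ × ℝ)) (hFne : ∀ i, (F i).Nonempty)
    (hF : ∀ i, ∀ p ∈ F i, p.1 ≤ p.2)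
    (S : A → Set ℝ) (hS : ∀ i, S i = ⋃ p ∈ F i, Set.Icc p.1 p.2)
    (Q : Finset ℝ) (hQcard : Q.card ≤ k)
    (hcover : ∀ i, ∃ q ∈ Q, q ∈ S i) :
    ∃ Q' : Finset ℝ, Q'.card ≤ k ∧
      (∀ q ∈ Q', ∃ i : A, ∃ p ∈ F i, q = p.1 ∨ q = p.2) ∧
      ∀ i, ∃ q ∈ Q', q ∈ S i := by
  classical
  let E : Finset ℝ := Finset.univ.biUnion fun i => (F i).image Prod.fst
  have hE : ∀ e, e ∈ E ↔ ∃ i, ∃ p ∈ F i, p.1 = e := by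
    intro e
    simp only [E, Finset.mem_biUnion, Finset.mem_univ, true_and, Finset.mem_image]
  have key : ∀ q : ℝ, ∃ e : ℝ, (∃ x ∈ E, x ≤ q) →
      e ∈ E ∧ e ≤ q ∧ ∀ x ∈ E, x ≤ q → x ≤ e := by
    intro q
    by_cases h : ∃ x ∈ E, x ≤ q
    · obtain ⟨x, hx, hxq⟩ := h
      obtain ⟨e, he, hmax⟩ := Finset.exists_max_image (E.filter (· ≤ q)) id
        ⟨x, Finset.mem_filter.2 ⟨hx, hxq⟩⟩
      rw [Finset.mem_filter] at he
      exact ⟨e, fun _ => ⟨he.1, he.2, fun y hy hyq =>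
        hmax y (Finset.mem_filter.2 ⟨hy, hyq⟩)⟩⟩
    · exact ⟨0, fun h' => absurd h' h⟩
  choose g hg using key
  refine ⟨(Q.filter fun q => ∃ x ∈ E, x ≤ q).image g, ?_, ?_, ?_⟩
  · exact (Finset.card_image_le.trans (Finset.card_filter_le _ _)).trans hQcard
  · intro q hq
    obtain ⟨r, hr, rfl⟩ := Finset.mem_image.1 hq
    obtain ⟨i, p, hp, h⟩ := (hE _).1 (hg r (Finset.mem_filter.1 hr).2).1
    exact ⟨i, p, hp, Or.inl h.symm⟩
  · intro i
    obtain ⟨q, hq, hqS⟩ := hcover i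
    rw [hS] at hqS
    simp only [Set.mem_iUnion] at hqS
    obtain ⟨p, hp, h1, h2⟩ := hqS
    have hpE : p.1 ∈ E := (hE _).2 ⟨i, p, hp, rfl⟩
    have hex : ∃ x ∈ E, x ≤ q := ⟨p.1, hpE, h1⟩
    obtain ⟨_, hle, hmax⟩ := hg q hex
    refine ⟨g q, Finset.mem_image.2 ⟨q, Finset.mem_filter.2 ⟨hq, hex⟩, rfl⟩, ?_⟩
    rw [hS]
    simp only [Set.mem_iUnion]
    exact ⟨p, hp, hmax _ hpE h1, hle.trans h2⟩
end

section
/- Let k ≥ 1 and n ≥ 1, let L : {1,…,k} → ℝ with L_s > 0 for all s, and for each i ∈ {1,…,n} and s ∈ {1,…,k} let F(i,s) be a nonempty finite set of pairs (a,b) of reals with 0 ≤ a < b ≤ L_s (each pair representing the open 'forbidden segment' (a,b)). For each s let E_s be the (finite) set of all endpoints a and b of pairs in ⋃_i F(i,s), let δ_s = min{ |x − y| : x, y ∈ E_s ∪ {0, L_s}, x ≠ y } restricted to pairs of endpoints of forbidden segments at positive distance (i.e., δ_s = min{ |x−y| : x,y endpoints of segments in ⋃_i F(i,s), x ≠ y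 }), and let δ = (1/2)·min_s δ_s (assume each E_s contains at least two distinct points, which holds since a < b). For a pair (a,b) ∈ F(i,s) define its shrunk interval [a♯, b♯] by a♯ = a if a = 0 and a♯ = a + δ otherwise, and b♯ = b if b = L_s and b♯ = b − δ otherwise. Define Γ = ∏_{s}(0, L_s), Γ′ = ∏_{s}[0, L_s], B_i = ⋃ over all choice functions σ with σ(s) ∈ F(i,s) of the open box ∏_s (a_{σ(s)}, b_{σ(s)}), and D_i = ⋃ over the same choice functions of the closed box ∏_s [a♯_{σ(s)}, b♯_{σ(s)}]. Then ⋃_{i=1}^n D_i ⊇ Γ′ if and only if ⋃_{i=1}^n B_i ⊇ Γ. -/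
/-- The left endpoint `a` of a forbidden segment, shrunk inward by `δ` unless `a = 0`. -/
noncomputable def shrinkLeft (δ a : ℝ) : ℝ := if a = 0 then a else a + δ

/-- The right endpoint `b` of a forbidden segment on an edge of length `Ls`, shrunk
inward by `δ` unless `b = Ls`. -/
noncomputable def shrinkRight (δ Ls b : ℝ) : ℝ := if b = Ls then b else b - δ

/-- One-coordinate perturbation: replace `x` by an interior point `y` such that every endpoint
strictly on one side of `y` is at distance at least `δ` from `x` on the same side. -/
lemma exists_perturbed (E : Finset ℝ) (l δ x : ℝ) (hl : 0 < l) (hδ : 0 < δ)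
    (hE : ∀ e ∈ E, 0 ≤ e ∧ e ≤ l)
    (hsep : ∀ e ∈ E, ∀ f ∈ E, e < f → 2 * δ ≤ f - e)
    (hx0 : 0 ≤ x) (hxl : x ≤ l) :
    ∃ y, 0 < y ∧ y < l ∧ (∀ e ∈ E, e ≠ 0 → e < y → e + δ ≤ x) ∧
      (∀ e ∈ E, e ≠ l → y < e → x ≤ e - δ) := by
  by_cases h : ∃ e ∈ E, 0 < e ∧ e < l ∧ |e - x| < δ
  · obtain ⟨e, he, h0, h1, h2⟩ := h
    rw [abs_lt] at h2
    refine ⟨e, h0, h1, fun f hf _ hlt => ?_, fun f hf _ hlt => ?_⟩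
    · linarith [hsep f hf e he hlt]
    · linarith [hsep e he f hf hlt]
  · push Not at h
    have hm : 0 < min δ l := lt_min hδ hl
    have hm1 : min δ l ≤ δ := min_le_left _ _
    have hm2 : min δ l ≤ l := min_le_right _ _
    have key : ∀ e ∈ E, 0 < e → e < l → e + δ ≤ x ∨ x ≤ e - δ := by
      intro e he h0 h1
      rcases le_abs.1 (h e he h0 h1) with h2 | h2
      · right; linarith
      · left; linarith
    have pos : ∀ e ∈ E, e ≠ 0 → 0 < e := fun e he hne => lt_of_le_of_ne (hE e he).1 hne.symm
    have ltl : ∀ e ∈ E, e ≠ l → e < l := fun e he hne => lt_of_le_of_ne (hE e he).2 hne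
    rcases hx0.eq_or_lt with rfl | hx0
    · refine ⟨min δ l / 2, by linarith, by linarith, fun e he hne hlt => ?_,
        fun e he hne hlt => ?_⟩
      · have := pos e he hne
        rcases key e he this (by linarith) with h2 | h2 <;> linarith
      · rcases key e he (by linarith) (ltl e he hne) with h2 | h2 <;> linarith
    rcases hxl.eq_or_lt with rfl | hxl
    · refine ⟨x - min δ x / 2, by linarith, by linarith, fun e he hne hlt => ?_,
        fun e he hne hlt => ?_⟩
      · rcases key e he (pos e he hne) (by linarith) with h2 | h2 <;> linarith
      · have := ltl e he hne
        rcases key e he (by linarith) this with h2 | h2 <;> linarith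
    · refine ⟨x, hx0, hxl, fun e he hne hlt => ?_, fun e he hne hlt => ?_⟩
      · rcases key e he (pos e he hne) (by linarith) with h2 | h2 <;> linarith
      · rcases key e he (by linarith) (ltl e he hne) with h2 | h2 <;> linarith

/-- For each `i` and each coordinate `s`, `F i s` is a nonempty finite
set of pairs `(a, b)` with `0 ≤ a < b ≤ L s`, representing open forbidden segments
`(a, b)` on the edge `(0, L s)`. With `δ` half the minimum positive distance between
endpoints of forbidden segments (over all coordinates), `B i` the union over choice
functions `σ` (with `σ s ∈ F i s`) of the open boxes `∏ s, ((σ s).1, (σ s).2)`, and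
`D i` the corresponding union of the closed shrunk boxes
`∏ s, [shrinkLeft δ (σ s).1, shrinkRight δ (L s) (σ s).2]`, the closed boxes `⋃ i, D i`
cover the closed box `Γ' = ∏ s, [0, L s]` iff the open boxes `⋃ i, B i` cover the open
box `Γ = ∏ s, (0, L s)`. -/
theorem shrunk_boxes_cover_iff (k n : ℕ) (hk : 1 ≤ k) (hn : 1 ≤ n)
    (L : Fin k → ℝ) (hL : ∀ s, 0 < L s)
    (F : Fin n → Fin k → Finset (ℝ × ℝ))
    (hFne : ∀ i s, (F i s).Nonempty)
    (hF : ∀ i s, ∀ p ∈ F i s, 0 ≤ p.1 ∧ p.1 < p.2 ∧ p.2 ≤ L s)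
    (Eset : Fin k → Finset ℝ)
    (hE : ∀ s, Eset s = (Finset.univ.biUnion fun i : Fin n => F i s).image Prod.fst ∪
                        (Finset.univ.biUnion fun i : Fin n => F i s).image Prod.snd)
    (δs : Fin k → ℝ)
    (hδs_mem : ∀ s, ∃ x ∈ Eset s, ∃ y ∈ Eset s, x ≠ y ∧ δs s = |x - y|)
    (hδs_min : ∀ s, ∀ x ∈ Eset s, ∀ y ∈ Eset s, x ≠ y → δs s ≤ |x - y|)
    (δ : ℝ) (hδ_mem : ∃ s, δ = δs s / 2) (hδ_min : ∀ s, δ ≤ δs s / 2) :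
    ({q : Fin k → ℝ | ∀ s, q s ∈ Set.Icc 0 (L s)} ⊆
        ⋃ i : Fin n, ⋃ σ ∈ {σ : Fin k → ℝ × ℝ | ∀ s, σ s ∈ F i s},
          {q : Fin k → ℝ | ∀ s,
            q s ∈ Set.Icc (shrinkLeft δ (σ s).1) (shrinkRight δ (L s) (σ s).2)}) ↔
    ({q : Fin k → ℝ | ∀ s, q s ∈ Set.Ioo 0 (L s)} ⊆
        ⋃ i : Fin n, ⋃ σ ∈ {σ : Fin k → ℝ × ℝ | ∀ s, σ s ∈ F i s},
          {q : Fin k → ℝ | ∀ s, q s ∈ Set.Ioo (σ s).1 (σ s).2}) := by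
  have hδ : 0 < δ := by
    obtain ⟨s, rfl⟩ := hδ_mem
    obtain ⟨x, _, y, _, hne, h⟩ := hδs_mem s
    rw [h]
    have := abs_pos.2 (sub_ne_zero.2 hne)
    linarith
  have hfst : ∀ i s, ∀ p ∈ F i s, p.1 ∈ Eset s := by
    intro i s p hp
    rw [hE, Finset.mem_union]
    exact Or.inl (Finset.mem_image_of_mem _ (Finset.mem_biUnion.2 ⟨i, Finset.mem_univ _, hp⟩))
  have hsnd : ∀ i s, ∀ p ∈ F i s, p.2 ∈ Eset s := by
    intro i s p hp
    rw [hE, Finset.mem_union]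
    exact Or.inr (Finset.mem_image_of_mem _ (Finset.mem_biUnion.2 ⟨i, Finset.mem_univ _, hp⟩))
  have hrange : ∀ s, ∀ e ∈ Eset s, 0 ≤ e ∧ e ≤ L s := by
    intro s e he
    rw [hE, Finset.mem_union, Finset.mem_image, Finset.mem_image] at he
    rcases he with ⟨p, hp, rfl⟩ | ⟨p, hp, rfl⟩ <;>
    · obtain ⟨i, _, hp⟩ := Finset.mem_biUnion.1 hp
      obtain ⟨h1, h2, h3⟩ := hF i s p hp
      constructor <;> linarith
  have hsep : ∀ s, ∀ e ∈ Eset s, ∀ f ∈ Eset s, e < f → 2 * δ ≤ f - e := by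
    intro s e he f hf hlt
    have h1 := hδs_min s f hf e he hlt.ne'
    rw [abs_of_pos (sub_pos.2 hlt)] at h1
    linarith [hδ_min s]
  constructor
  · intro h q hq
    have hq' := h (show q ∈ {q : Fin k → ℝ | ∀ s, q s ∈ Set.Icc 0 (L s)} from
      fun s => ⟨(hq s).1.le, (hq s).2.le⟩)
    simp only [Set.mem_iUnion] at hq' ⊢
    obtain ⟨i, σ, hσ, hm⟩ := hq'
    refine ⟨i, σ, hσ, fun s => ?_⟩
    obtain ⟨h1, h2⟩ := hm s
    obtain ⟨h3, h4⟩ := hq s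
    unfold shrinkLeft at h1
    unfold shrinkRight at h2
    constructor
    · split_ifs at h1 <;> linarith
    · split_ifs at h2 <;> linarith
  · intro h q hq
    choose y hy0 hyl hya hyb using fun s => exists_perturbed (Eset s) (L s) δ (q s) (hL s) hδ
      (hrange s) (hsep s) (hq s).1 (hq s).2
    have hy' := h (show y ∈ {q : Fin k → ℝ | ∀ s, q s ∈ Set.Ioo 0 (L s)} from
      fun s => ⟨hy0 s, hyl s⟩)
    simp only [Set.mem_iUnion] at hy' ⊢
    obtain ⟨i, σ, hσ, hm⟩ := hy'
    refine ⟨i, σ, hσ, fun s => ?_⟩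
    obtain ⟨h1, h2⟩ := hm s
    obtain ⟨h3, h4⟩ := hq s
    constructor
    · unfold shrinkLeft
      split_ifs with h0
      · linarith
      · exact hya s _ (hfst i s _ (hσ s)) h0 h1
    · unfold shrinkRight
      split_ifs with h0
      · linarith
      · exact hyb s _ (hsnd i s _ (hσ s)) h0 h2
end
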